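/- Let R be a commutative ring. Every GV-torsion-free weak w-projective R-module M is torsion-free, i.e., if r ∈ R is a non-zero-divisor of R, x ∈ M, and r x = 0, then x = 0. -/

import Mathlib

/-!  Background definitions for the `w`-operation theory of Wang–Kim–Qiao.  -/

open CategoryTheory

section WTheory

variable (R : Type) [CommRing R]

/-- `J` is a Glaz–Vasconcelos ideal: it is finitely generated and the natural map
`R → Hom_R(J, R)`, sending `r` to multiplication by `r`, is bijective. -/
def IsGVIdeal (J : Ideal R) : Prop :=
  J.FG ∧ Function.Bijective fun r : R => (r • J.subtype : J →ₗ[R] R)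

/-- `M` is `GV`-torsion: every element is annihilated by some GV-ideal. -/
def IsGVTorsion (M : Type*) [AddCommGroup M] [Module R M] : Prop :=
  ∀ x : M, ∃ J : Ideal R, IsGVIdeal R J ∧ ∀ j ∈ J, j • x = 0

/-- `M` is `GV`-torsion-free: no nonzero element is annihilated by a GV-ideal. -/
def IsGVTorsionFree (M : Type*) [AddCommGroup M] [Module R M] : Prop :=
  ∀ x : M, (∃ J : Ideal R, IsGVIdeal R J ∧ ∀ j ∈ J, j • x = 0) → x = 0

/-- `Ext^n_R(M, N)`, as an `R`-module. -/
noncomputable def extM (M N : Type) [AddCommGroup M] [Module R M]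
    [AddCommGroup N] [Module R N] (n : ℕ) : ModuleCat R :=
  ((Ext R (ModuleCat R) n).obj (Opposite.op (ModuleCat.of R M))).obj (ModuleCat.of R N)

/-- `M` is a `w`-module: it is GV-torsion-free and `Ext^1_R(R/J, M) = 0`
for every GV-ideal `J`. -/
def IsWModule (M : Type) [AddCommGroup M] [Module R M] : Prop :=
  IsGVTorsionFree R M ∧
    ∀ J : Ideal R, IsGVIdeal R J → Subsingleton (extM R (R ⧸ J) M 1)

/-- `(L, ι)` is a `w`-envelope of `M`: `L` is a `w`-module, `ι : M → L` is an injective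
linear map, and its cokernel is GV-torsion. -/
def IsWEnvelope (M L : Type) [AddCommGroup M] [Module R M] [AddCommGroup L]
    [Module R L] (ι : M →ₗ[R] L) : Prop :=
  IsWModule R L ∧ Function.Injective ι ∧ IsGVTorsion R (L ⧸ LinearMap.range ι)

/-- The GV-torsion submodule `tor_GV(M)`.  (The displayed generating set is already closed
under the module operations, since the GV-ideals form a multiplicative system of ideals,
so the span coincides with the displayed set.) -/
def torGV (M : Type) [AddCommGroup M] [Module R M] : Submodule R M :=
  Submodule.span R {x : M | ∃ J : Ideal R, IsGVIdeal R J ∧ ∀ j ∈ J, j • x = 0}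

/-- `M` is `w`-projective: for every GV-torsion-free `w`-module `N` and every
`w`-envelope `(L, ι)` of `M / tor_GV(M)`, the module `Ext^1_R(L, N)` is GV-torsion. -/
def IsWProjective (M : Type) [AddCommGroup M] [Module R M] : Prop :=
  ∀ (N : Type) [AddCommGroup N] [Module R N], IsGVTorsionFree R N → IsWModule R N →
    ∀ (L : Type) [AddCommGroup L] [Module R L] (ι : (M ⧸ torGV R M) →ₗ[R] L),
      IsWEnvelope R (M ⧸ torGV R M) L ι → IsGVTorsion R (extM R L N 1)

/-- `N` belongs to the class `P_w^{†∞}`: it is GV-torsion-free and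
`Ext^k_R(M, N) = 0` for every `w`-projective `M` and every `k ≥ 1`. -/
def MemPwDaggerInfty (N : Type) [AddCommGroup N] [Module R N] : Prop :=
  IsGVTorsionFree R N ∧
    ∀ (M : Type) [AddCommGroup M] [Module R M], IsWProjective R M →
      ∀ k : ℕ, 1 ≤ k → Subsingleton (extM R M N k)

/-- `M` is weak `w`-projective: `Ext^1_R(M, N) = 0` for every `N ∈ P_w^{†∞}`. -/
def IsWeakWProjective (M : Type) [AddCommGroup M] [Module R M] : Prop :=
  ∀ (N : Type) [AddCommGroup N] [Module R N], MemPwDaggerInfty R N →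
    Subsingleton (extM R M N 1)

end WTheory

section Resolution

variable {R : Type} [CommRing R] {M : Type} [AddCommGroup M] [Module R M]
  (P : ProjectiveResolution (ModuleCat.of R M))

/-- `Ext` vanishes in degree `n + 1` if every `(n + 1)`-cocycle is a coboundary. -/
lemma subsingleton_extM_succ (N : Type) [AddCommGroup N] [Module R N] (n : ℕ)
    (h : ∀ f : P.complex.X (n + 1) →ₗ[R] N, f ∘ₗ (P.complex.d (n + 2) (n + 1)).hom = 0 →
      ∃ g : P.complex.X n →ₗ[R] N, g ∘ₗ (P.complex.d (n + 1) n).hom = f) :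
    Subsingleton (extM R M N (n + 1)) := by
  refine ModuleCat.subsingleton_of_isZero (Limits.IsZero.of_iso ?_
    (P.isoExt (n + 1) (ModuleCat.of R N)))
  rw [← HomologicalComplex.exactAt_iff_isZero_homology,
    HomologicalComplex.exactAt_iff' _ n (n + 1) (n + 2) (by simp) (by simp),
    ShortComplex.moduleCat_exact_iff]
  intro (f : P.complex.X (n + 1) ⟶ ModuleCat.of R N) hf
  change P.complex.d (n + 2) (n + 1) ≫ f = 0 at hf
  obtain ⟨g, hg⟩ := h f.hom (by simpa using congrArg ModuleCat.Hom.hom hf)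
  exact ⟨(ModuleCat.ofHom g : P.complex.X n ⟶ ModuleCat.of R N), ModuleCat.hom_ext hg⟩

lemma exists_comp_d_eq_smul (N : Type) [AddCommGroup N] [Module R N] (n : ℕ)
    (h : IsGVTorsion R (extM R M N (n + 1)))
    (f : P.complex.X (n + 1) →ₗ[R] N) (hf : f ∘ₗ (P.complex.d (n + 2) (n + 1)).hom = 0) :
    ∃ J : Ideal R, IsGVIdeal R J ∧ ∀ j ∈ J,
      ∃ g : P.complex.X n →ₗ[R] N, g ∘ₗ (P.complex.d (n + 1) n).hom = j • f := by
  let K := P.complex.linearYonedaObj R (ModuleCat.of R N)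
  let S := K.sc' n (n + 1) (n + 2)
  let e : extM R M N (n + 1) ≅ S.moduleCatLeftHomologyData.H :=
    P.isoExt (n + 1) (ModuleCat.of R N) ≪≫
      ShortComplex.homologyMapIso (K.isoSc' n (n + 1) (n + 2) (by simp) (by simp)) ≪≫
      S.moduleCatHomologyIso
  have hf' : S.g (ModuleCat.ofHom f : P.complex.X (n + 1) ⟶ ModuleCat.of R N) = 0 :=
    ModuleCat.hom_ext hf
  let c : LinearMap.ker S.g.hom := ⟨_, hf'⟩
  let z : S.moduleCatLeftHomologyData.H := (LinearMap.range S.moduleCatToCycles).mkQ c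
  obtain ⟨J, hJ, hz⟩ := h (e.inv z)
  refine ⟨J, hJ, fun j hj => ?_⟩
  have h0 : (LinearMap.range S.moduleCatToCycles).mkQ (j • c) = 0 := by
    have := congrArg e.hom (hz j hj)
    rw [map_smul, map_zero, Iso.inv_hom_id_apply] at this
    exact (map_smul _ j c).trans this
  rw [Submodule.mkQ_apply, Submodule.Quotient.mk_eq_zero] at h0
  obtain ⟨g, hg⟩ := h0
  let g' : P.complex.X n ⟶ ModuleCat.of R N := g
  exact ⟨g'.hom, congrArg ModuleCat.Hom.hom (congrArg Subtype.val hg)⟩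

lemma ker_d_eq (n : ℕ) : LinearMap.ker (P.complex.d (n + 1) n).hom =
    LinearMap.range (P.complex.d (n + 2) (n + 1)).hom :=
  (P.exact_succ n).moduleCat_range_eq_ker.symm

/-- The augmentation of a projective resolution, as a linear map. -/
noncomputable def augmentation : P.complex.X 0 →ₗ[R] M :=
  (P.π.f 0).hom

lemma augmentation_surjective : Function.Surjective (augmentation P) :=
  (ModuleCat.epi_iff_surjective (P.π.f 0)).1 inferInstance

lemma ker_augmentation : LinearMap.ker (augmentation P) =
    LinearMap.range (P.complex.d 1 0).hom :=
  P.exact₀.moduleCat_range_eq_ker.symm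

end Resolution

section Injective

variable {R : Type} [CommRing R]

/-- A map into an injective module extends along any map with smaller kernel. -/
lemma exists_comp_eq_of_ker_le {A B E : Type} [AddCommGroup A] [Module R A] [AddCommGroup B]
    [Module R B] [AddCommGroup E] [Module R E] [Module.Injective R E]
    (a : A →ₗ[R] B) (f : A →ₗ[R] E) (h : LinearMap.ker a ≤ LinearMap.ker f) :
    ∃ g : B →ₗ[R] E, g ∘ₗ a = f := by
  obtain ⟨g, hg⟩ := Module.Injective.out
    ((LinearMap.ker a).liftQ a le_rfl)
    (LinearMap.ker_eq_bot.1 (Submodule.ker_liftQ_eq_bot _ _ _ le_rfl))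
    ((LinearMap.ker a).liftQ f h)
  exact ⟨g, LinearMap.ext fun x => by simpa using hg (Submodule.Quotient.mk x)⟩

variable {E : Type} [AddCommGroup E] [Module R E] [Module.Injective R E]

/-- A map into an injective module that kills the `r`-torsion is divisible by `r`. -/
lemma exists_smul_eq_of_torsionBy_le_ker {W : Type} [AddCommGroup W] [Module R W] (r : R)
    (h : W →ₗ[R] E) (hr : ∀ w : W, r • w = 0 → h w = 0) : ∃ g : W →ₗ[R] E, r • g = h := by
  obtain ⟨g, hg⟩ := exists_comp_eq_of_ker_le (LinearMap.lsmul R W r) h (fun w hw => hr w hw)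
  refine ⟨g, ?_⟩
  rw [← hg]
  ext w
  simp

lemma smul_surjective_of_injective {r : R} (hr : ∀ a : R, r * a = 0 → a = 0) (e : E) :
    ∃ e' : E, r • e' = e := by
  obtain ⟨g, hg⟩ := exists_smul_eq_of_torsionBy_le_ker r (LinearMap.toSpanSingleton R E e)
    (fun a ha => by simp [hr a ha])
  exact ⟨g 1, by simpa using congrArg (fun k : R →ₗ[R] E => k 1) hg⟩

lemma exists_smul_eq_of_projective {r : R} (hr : ∀ a : R, r * a = 0 → a = 0)
    {Q : Type} [AddCommGroup Q] [Module R Q] [Module.Projective R Q] (h : Q →ₗ[R] E) :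
    ∃ g : Q →ₗ[R] E, r • g = h := by
  obtain ⟨g, hg⟩ := Module.projective_lifting_property (LinearMap.lsmul R E r) h
    (smul_surjective_of_injective hr)
  refine ⟨g, ?_⟩
  rw [← hg]
  ext w
  simp

/-- `Ext` in positive degrees with values in the `r`-torsion of an injective module vanishes
as soon as the maps from `W` to that injective module kill the `r`-torsion of `W`. -/
lemma subsingleton_extM_torsionBy {r : R} (hr : ∀ a : R, r * a = 0 → a = 0)
    {W : Type} [AddCommGroup W] [Module R W]
    (hW : ∀ (h : W →ₗ[R] E) (w : W), r • w = 0 → h w = 0) (n : ℕ) :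
    Subsingleton (extM R W (Submodule.torsionBy R E r) (n + 1)) := by
  let P := projectiveResolution (ModuleCat.of R W)
  have hproj (k : ℕ) : Module.Projective R (P.complex.X k) :=
    (IsProjective.iff_projective (R := R) (P.complex.X k)).2 (P.projective k)
  refine subsingleton_extM_succ P _ n fun f hf => ?_
  obtain ⟨g, hg⟩ := exists_comp_eq_of_ker_le (P.complex.d (n + 1) n).hom
    ((Submodule.torsionBy R E r).subtype ∘ₗ f) (by
      rw [ker_d_eq, LinearMap.range_le_ker_iff, LinearMap.comp_assoc, hf, LinearMap.comp_zero])
  have hgr : (r • g) ∘ₗ (P.complex.d (n + 1) n).hom = 0 := by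
    rw [LinearMap.smul_comp, hg]
    ext x
    simp
  obtain ⟨g', hg', hg'd⟩ : ∃ g' : P.complex.X n →ₗ[R] E, r • g' = r • g ∧
      g' ∘ₗ (P.complex.d (n + 1) n).hom = 0 := by
    cases n with
    | zero =>
      obtain ⟨h, hh⟩ := exists_comp_eq_of_ker_le (augmentation P) (r • g) (by
        rw [ker_augmentation, LinearMap.range_le_ker_iff, hgr])
      obtain ⟨h', rfl⟩ := exists_smul_eq_of_torsionBy_le_ker r h (hW h)
      refine ⟨h' ∘ₗ augmentation P, by rw [← hh, LinearMap.smul_comp], ?_⟩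
      rw [LinearMap.comp_assoc, LinearMap.range_le_ker_iff.1 (ker_augmentation P).ge,
        LinearMap.comp_zero]
    | succ k =>
      obtain ⟨h, hh⟩ := exists_comp_eq_of_ker_le (P.complex.d (k + 1) k).hom (r • g) (by
        rw [ker_d_eq, LinearMap.range_le_ker_iff, hgr])
      obtain ⟨h', rfl⟩ := exists_smul_eq_of_projective hr h
      refine ⟨h' ∘ₗ (P.complex.d (k + 1) k).hom, by rw [← hh, LinearMap.smul_comp], ?_⟩
      rw [LinearMap.comp_assoc, LinearMap.range_le_ker_iff.1 (ker_d_eq P k).ge,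
        LinearMap.comp_zero]
  refine ⟨(g - g').codRestrict _ fun x => ?_, ?_⟩
  · have := LinearMap.congr_fun hg' x
    simp only [LinearMap.smul_apply] at this
    simp [smul_sub, this]
  · ext x
    have h1 := LinearMap.congr_fun hg x
    have h2 := LinearMap.congr_fun hg'd x
    simp only [LinearMap.comp_apply, Submodule.subtype_apply, LinearMap.zero_apply] at h1 h2
    simp [h1, h2]

/-- If `Ext¹` with values in the `r`-torsion of a `GV`-torsion-free injective module is
`GV`-torsion, then the maps to that injective module kill the `r`-torsion. -/
lemma map_eq_zero_of_isGVTorsion_extM {r : R} (hr : ∀ a : R, r * a = 0 → a = 0)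
    (hE : IsGVTorsionFree R E) {L : Type} [AddCommGroup L] [Module R L]
    (hL : IsGVTorsion R (extM R L (Submodule.torsionBy R E r) 1))
    (h : L →ₗ[R] E) (w : L) (hw : r • w = 0) : h w = 0 := by
  let P := projectiveResolution (ModuleCat.of R L)
  have hproj : Module.Projective R (P.complex.X 0) :=
    (IsProjective.iff_projective (R := R) (P.complex.X 0)).2 (P.projective 0)
  have hπd : augmentation P ∘ₗ (P.complex.d 1 0).hom = 0 :=
    LinearMap.range_le_ker_iff.1 (ker_augmentation P).ge
  obtain ⟨g, hg⟩ := exists_smul_eq_of_projective hr (h ∘ₗ augmentation P)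
  have hgr : r • (g ∘ₗ (P.complex.d 1 0).hom) = 0 := by
    rw [← LinearMap.smul_comp, hg, LinearMap.comp_assoc, hπd, LinearMap.comp_zero]
  have hdd : (P.complex.d 1 0).hom ∘ₗ (P.complex.d 2 1).hom = 0 :=
    LinearMap.range_le_ker_iff.1 (ker_d_eq P 0).ge
  let f : P.complex.X 1 →ₗ[R] Submodule.torsionBy R E r :=
    (g ∘ₗ (P.complex.d 1 0).hom).codRestrict _ fun x => LinearMap.congr_fun hgr x
  obtain ⟨J, hJ, hJg⟩ := exists_comp_d_eq_smul P (Submodule.torsionBy R E r) 0 hL f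
    (LinearMap.ext fun x => Subtype.ext
      ((congrArg g (LinearMap.congr_fun hdd x)).trans (map_zero g)))
  refine hE _ ⟨J, hJ, fun j hj => ?_⟩
  obtain ⟨g', hg'⟩ := hJg j hj
  obtain ⟨v, hv⟩ := exists_comp_eq_of_ker_le (augmentation P)
    (j • g - (Submodule.torsionBy R E r).subtype ∘ₗ g') (by
      rw [ker_augmentation, LinearMap.range_le_ker_iff]
      ext x
      exact sub_eq_zero.2 (congrArg Subtype.val (LinearMap.congr_fun hg' x)).symm)
  obtain ⟨y, rfl⟩ := augmentation_surjective P w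
  have h1 : r • g y = h (augmentation P y) := LinearMap.congr_fun hg y
  have h2 : v (augmentation P y) = j • g y - g' y := LinearMap.congr_fun hv y
  have h3 : r • (g' y : E) = 0 := (g' y).2
  calc j • h (augmentation P y) = r • v (augmentation P y) := by
        rw [h2, smul_sub, h3, sub_zero, ← h1, smul_comm]
    _ = 0 := by rw [← map_smul, hw, map_zero]

end Injective

section GVIdeals

variable {R : Type} [CommRing R]

lemma isGVIdeal_top : IsGVIdeal R ⊤ := by
  refine ⟨⟨{1}, by simp⟩, fun a b hab => ?_, fun f => ⟨f ⟨1, trivial⟩, ?_⟩⟩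
  · simpa using LinearMap.congr_fun hab ⟨1, trivial⟩
  · ext x
    have : x = (x : R) • (⟨1, trivial⟩ : (⊤ : Ideal R)) := Subtype.ext (by simp)
    conv_rhs => rw [this, map_smul]
    simp [mul_comm]

lemma IsGVIdeal.eq_zero {J : Ideal R} (hJ : IsGVIdeal R J) {a : R} (ha : ∀ j ∈ J, a * j = 0) :
    a = 0 :=
  hJ.2.1 (LinearMap.ext fun j => by simpa using ha j j.2)

lemma IsGVIdeal.mul {I J : Ideal R} (hI : IsGVIdeal R I) (hJ : IsGVIdeal R J) :
    IsGVIdeal R (I * J) := by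
  refine ⟨Submodule.FG.mul hI.1 hJ.1, fun a b hab => ?_, fun f => ?_⟩
  · refine sub_eq_zero.1 (hI.eq_zero fun i hi => hJ.eq_zero fun j hj => ?_)
    have : a * (i * j) = b * (i * j) :=
      LinearMap.congr_fun hab ⟨i * j, Ideal.mul_mem_mul hi hj⟩
    linear_combination this
  · let m (i : I) : J →ₗ[R] (I * J : Ideal R) :=
      (LinearMap.mulLeft R (i : R) ∘ₗ J.subtype).codRestrict _
        fun j => Ideal.mul_mem_mul i.2 j.2
    choose g hg using fun i : I => hJ.2.2 (f ∘ₗ m i)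
    have hg' (i : I) (j : J) : g i * j = f (m i j) := LinearMap.congr_fun (hg i) j
    let gl : I →ₗ[R] R :=
      { toFun := g
        map_add' := fun a b => by
          refine sub_eq_zero.1 (hJ.eq_zero fun j hj => ?_)
          have h0 : m (a + b) ⟨j, hj⟩ = m a ⟨j, hj⟩ + m b ⟨j, hj⟩ :=
            Subtype.ext (add_mul (a : R) b j)
          have h1 := hg' (a + b) ⟨j, hj⟩
          rw [h0, map_add, ← hg', ← hg'] at h1
          linear_combination h1
        map_smul' := fun c a => by
          refine sub_eq_zero.1 (hJ.eq_zero fun j hj => ?_)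
          have h0 : m (c • a) ⟨j, hj⟩ = c • m a ⟨j, hj⟩ :=
            Subtype.ext (mul_assoc c (a : R) j)
          have h1 := hg' (c • a) ⟨j, hj⟩
          rw [h0, map_smul, ← hg'] at h1
          simp only [smul_eq_mul, RingHom.id_apply] at h1 ⊢
          linear_combination h1 }
    obtain ⟨c, hc⟩ := hI.2.2 gl
    have hc' (i : I) : c * i = g i := LinearMap.congr_fun hc i
    refine ⟨c, LinearMap.ext fun ⟨x, hx⟩ => ?_⟩
    change c * x = f ⟨x, hx⟩
    induction hx using Submodule.mul_induction_on' with
    | mem_mul_mem i hi j hj =>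
      have := hg' ⟨i, hi⟩ ⟨j, hj⟩
      rw [← hc'] at this
      exact (mul_assoc c i j).symm.trans this
    | add x hx y hy h1 h2 =>
      rw [mul_add, h1, h2, ← map_add]
      rfl

variable {M : Type} [AddCommGroup M] [Module R M]

/-- The elements that some GV-ideal multiplies into `K`. -/
def gvClosure (K : Submodule R M) : Submodule R M where
  carrier := {x | ∃ J : Ideal R, IsGVIdeal R J ∧ ∀ j ∈ J, j • x ∈ K}
  zero_mem' := ⟨⊤, isGVIdeal_top, fun j _ => by simp⟩
  add_mem' := by
    rintro x y ⟨I, hI, hx⟩ ⟨J, hJ, hy⟩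
    refine ⟨I * J, hI.mul hJ, fun j hj => ?_⟩
    rw [smul_add]
    exact add_mem (hx j (Ideal.mul_le_left hj)) (hy j (Ideal.mul_le_right hj))
  smul_mem' := by
    rintro c x ⟨J, hJ, hx⟩
    refine ⟨J, hJ, fun j hj => ?_⟩
    rw [smul_comm]
    exact K.smul_mem c (hx j hj)

lemma le_gvClosure (K : Submodule R M) : K ≤ gvClosure K :=
  fun _ hx => ⟨⊤, isGVIdeal_top, fun j _ => K.smul_mem j hx⟩

lemma exists_isGVIdeal_of_fg_le_gvClosure {K : Submodule R M} (N : Submodule R M) (hN : N.FG)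
    (h : N ≤ gvClosure K) : ∃ J : Ideal R, IsGVIdeal R J ∧ ∀ j ∈ J, ∀ n ∈ N, j • n ∈ K := by
  induction N, hN using Submodule.fg_induction with
  | singleton x =>
    obtain ⟨J, hJ, hx⟩ := h (Submodule.mem_span_singleton_self x)
    refine ⟨J, hJ, fun j hj n hn => ?_⟩
    obtain ⟨c, rfl⟩ := Submodule.mem_span_singleton.1 hn
    rw [smul_comm]
    exact K.smul_mem c (hx j hj)
  | sup N₁ N₂ _ _ h₁ h₂ =>
    obtain ⟨I, hI, hIx⟩ := h₁ (le_sup_left.trans h)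
    obtain ⟨J, hJ, hJx⟩ := h₂ (le_sup_right.trans h)
    refine ⟨I * J, hI.mul hJ, fun j hj n hn => ?_⟩
    obtain ⟨a, ha, b, hb, rfl⟩ := Submodule.mem_sup.1 hn
    rw [smul_add]
    exact add_mem (hIx j (Ideal.mul_le_left hj) a ha) (hJx j (Ideal.mul_le_right hj) b hb)

lemma mem_gvClosure_of_smul_mem {K : Submodule R M} {J : Ideal R} (hJ : IsGVIdeal R J) {x : M}
    (hx : ∀ j ∈ J, j • x ∈ gvClosure K) : x ∈ gvClosure K := by
  obtain ⟨I, hI, hIx⟩ := exists_isGVIdeal_of_fg_le_gvClosure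
    (Submodule.map (LinearMap.toSpanSingleton R M x) J) (Submodule.FG.map _ hJ.1) (by
      rintro _ ⟨j, hj, rfl⟩
      exact hx j hj)
  refine ⟨I * J, hI.mul hJ, fun k hk => ?_⟩
  induction hk using Submodule.mul_induction_on' with
  | mem_mul_mem i hi j hj =>
    rw [mul_smul]
    exact hIx i hi _ ⟨j, hj, rfl⟩
  | add a _ b _ ha hb =>
    rw [add_smul]
    exact add_mem ha hb

lemma isGVTorsionFree_quotient_gvClosure (K : Submodule R M) :
    IsGVTorsionFree R (M ⧸ gvClosure K) := by
  rintro x ⟨J, hJ, hx⟩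
  obtain ⟨x, rfl⟩ := Submodule.Quotient.mk_surjective _ x
  refine (Submodule.Quotient.mk_eq_zero _).2 (mem_gvClosure_of_smul_mem hJ fun j hj => ?_)
  rw [← Submodule.Quotient.mk_eq_zero, Submodule.Quotient.mk_smul]
  exact hx j hj

lemma gvClosure_bot : gvClosure ⊥ = torGV R M := by
  refine le_antisymm (fun x hx => Submodule.subset_span ?_) (Submodule.span_le.2 fun x hx => ?_)
  · obtain ⟨J, hJ, hx⟩ := hx
    exact ⟨J, hJ, fun j hj => by simpa using hx j hj⟩
  · obtain ⟨J, hJ, hx⟩ := hx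
    exact ⟨J, hJ, fun j hj => by simpa using hx j hj⟩

lemma isGVTorsionFree_quotient_torGV : IsGVTorsionFree R (M ⧸ torGV R M) := by
  rw [← gvClosure_bot]
  exact isGVTorsionFree_quotient_gvClosure ⊥

lemma IsGVTorsionFree.submodule (h : IsGVTorsionFree R M) (N : Submodule R M) :
    IsGVTorsionFree R N := by
  rintro x ⟨J, hJ, hx⟩
  exact Subtype.ext (h x ⟨J, hJ, fun j hj => congrArg Subtype.val (hx j hj)⟩)

lemma isGVTorsion_quotient {J : Ideal R} (hJ : IsGVIdeal R J) : IsGVTorsion R (R ⧸ J) := by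
  intro x
  obtain ⟨x, rfl⟩ := Ideal.Quotient.mk_surjective x
  refine ⟨J, hJ, fun j hj => ?_⟩
  change Ideal.Quotient.mk J (j * x) = 0
  exact Ideal.Quotient.eq_zero_iff_mem.2 (J.mul_mem_right x hj)

lemma IsGVTorsion.map_eq_zero {N : Type} [AddCommGroup N] [Module R N] (hM : IsGVTorsion R M)
    (hN : IsGVTorsionFree R N) (f : M →ₗ[R] N) (x : M) : f x = 0 := by
  obtain ⟨J, hJ, hx⟩ := hM x
  exact hN _ ⟨J, hJ, fun j hj => by rw [← map_smul, hx j hj, map_zero]⟩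

lemma isGVTorsion_of_subsingleton [Subsingleton M] : IsGVTorsion R M :=
  fun _ => ⟨⊤, isGVIdeal_top, fun _ _ => Subsingleton.elim _ _⟩

/-- An ideal containing no GV-ideal lies in a prime ideal containing no GV-ideal. -/
lemma exists_isPrime_forall_not_le (I : Ideal R) (hI : ∀ J, IsGVIdeal R J → ¬ J ≤ I) :
    ∃ p : Ideal R, p.IsPrime ∧ I ≤ p ∧ ∀ J, IsGVIdeal R J → ¬ J ≤ p := by
  obtain ⟨p, hIp, hp⟩ := zorn_le_nonempty₀ {p : Ideal R | ∀ J, IsGVIdeal R J → ¬ J ≤ p}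
    (fun c hc hchain y hy => ⟨sSup c, fun J hJ hle => by
      obtain ⟨q, hq, hJq⟩ := (Submodule.fg_iff_compact J).1 hJ.1 c _ ⟨y, hy⟩
        hchain.directedOn (isLUB_sSup c) hle
      exact hc hq J hJ hJq, fun z hz => le_sSup hz⟩) I hI
  have key (a : R) (ha : a ∉ p) : ∃ J, IsGVIdeal R J ∧ J ≤ p ⊔ Ideal.span {a} := by
    by_contra! h
    exact ha (hp.le_of_ge h le_sup_left (Ideal.mem_sup_right (Ideal.mem_span_singleton_self a)))
  refine ⟨p, ⟨?_, fun {a b} hab => ?_⟩, hIp, hp.1⟩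
  · rintro rfl
    exact hp.1 ⊤ isGVIdeal_top le_rfl
  · by_contra! h
    obtain ⟨J₁, hJ₁, h₁⟩ := key a h.1
    obtain ⟨J₂, hJ₂, h₂⟩ := key b h.2
    refine hp.1 _ (hJ₁.mul hJ₂) ((Ideal.mul_mono h₁ h₂).trans ?_)
    rw [Ideal.sup_mul, Ideal.mul_sup (Ideal.span {a}), Ideal.span_singleton_mul_span_singleton]
    exact sup_le Ideal.mul_le_left
      (sup_le Ideal.mul_le_right ((Ideal.span_singleton_le_iff_mem _).2 hab))

end GVIdeals

section WEnvelope

variable {R : Type} [CommRing R]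

lemma isGVTorsionFree_characterModule_localization (p : Ideal R) [p.IsPrime]
    (hp : ∀ J, IsGVIdeal R J → ¬ J ≤ p) :
    IsGVTorsionFree R (CharacterModule (Localization.AtPrime p)) := by
  rintro c ⟨J, hJ, hc⟩
  obtain ⟨j, hj, hjp⟩ := SetLike.not_le_iff_exists.1 (hp J hJ)
  ext y
  obtain ⟨z, rfl⟩ : ∃ z : Localization.AtPrime p, j • z = y := by
    have hu := IsLocalization.map_units (Localization.AtPrime p) (⟨j, hjp⟩ : p.primeCompl)
    exact ⟨hu.unit⁻¹.1 * y, by rw [Algebra.smul_def, ← mul_assoc]; simp [hu.mul_val_inv]⟩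
  exact DFunLike.congr_fun (hc j hj) z

instance injective_characterModule_localization (p : Ideal R) [p.IsPrime] :
    Module.Injective R (CharacterModule (Localization.AtPrime p)) :=
  have : Module.Flat R (Localization.AtPrime p) := IsLocalization.flat _ p.primeCompl
  Module.Flat.iff_characterModule_injective.1 this

variable {X : Type} [AddCommGroup X] [Module R X]

lemma exists_map_characterModule_localization_ne_zero (hX : IsGVTorsionFree R X) {x : X}
    (hx : x ≠ 0) : ∃ p : PrimeSpectrum R, (∀ J, IsGVIdeal R J → ¬ J ≤ p.asIdeal) ∧
      ∃ h : X →ₗ[R] CharacterModule (Localization.AtPrime p.asIdeal), h x ≠ 0 := by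
  obtain ⟨p, hp, hle, hpJ⟩ := exists_isPrime_forall_not_le
    (LinearMap.ker (LinearMap.toSpanSingleton R X x)) fun J hJ hle =>
      hx (hX x ⟨J, hJ, fun j hj => hle hj⟩)
  let k := p.ResidueField
  obtain ⟨c, hc⟩ := CharacterModule.exists_character_apply_ne_zero_of_ne_zero (one_ne_zero (α := k))
  let π : Localization.AtPrime p →ₗ[R] k :=
    (IsScalarTower.toAlgHom R (Localization.AtPrime p) k).toLinearMap
  obtain ⟨h, hh⟩ := exists_comp_eq_of_ker_le (LinearMap.toSpanSingleton R X x)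
    (LinearMap.toSpanSingleton R _ (CharacterModule.dual π c)) (fun a ha => by
      refine CharacterModule.ext _ fun y => ?_
      change c (π (a • y)) = 0
      rw [map_smul, Algebra.smul_def, (Ideal.algebraMap_residueField_eq_zero).2 (hle ha),
        zero_mul, map_zero])
  refine ⟨⟨p, hp⟩, hpJ, h, fun h0 => hc ?_⟩
  have h1 := LinearMap.congr_fun hh 1
  simp only [LinearMap.comp_apply, LinearMap.toSpanSingleton_apply, one_smul, h0] at h1
  have h2 : 0 = c (π 1) := DFunLike.congr_fun h1 1
  rw [h2]
  exact congrArg c (map_one (IsScalarTower.toAlgHom R (Localization.AtPrime p) k)).symm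

/-- A `GV`-torsion-free module embeds in a `GV`-torsion-free injective module. -/
lemma exists_injective_isGVTorsionFree_embedding (hX : IsGVTorsionFree R X) :
    ∃ (E : Type) (_ : AddCommGroup E) (_ : Module R E), Module.Injective R E ∧
      IsGVTorsionFree R E ∧ ∃ i : X →ₗ[R] E, Function.Injective i := by
  choose p hp h hh using fun x : {x : X // x ≠ 0} =>
    exists_map_characterModule_localization_ne_zero hX x.2
  refine ⟨∀ x, CharacterModule (Localization.AtPrime (p x).asIdeal), inferInstance, inferInstance,
    inferInstance, ?_, LinearMap.pi h, ?_⟩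
  · rintro f ⟨J, hJ, hf⟩
    exact funext fun x => isGVTorsionFree_characterModule_localization _ (hp x) _
      ⟨J, hJ, fun j hj => congrFun (hf j hj) x⟩
  · refine (injective_iff_map_eq_zero _).2 fun x hx => ?_
    by_contra hx0
    exact hh ⟨x, hx0⟩ (congrFun hx ⟨x, hx0⟩)

variable {E : Type} [AddCommGroup E] [Module R E] [Module.Injective R E]

lemma isWModule_gvClosure (hE : IsGVTorsionFree R E) (K : Submodule R E) :
    IsWModule R (gvClosure K) := by
  refine ⟨hE.submodule _, fun J hJ => ?_⟩
  let P := projectiveResolution (ModuleCat.of R (R ⧸ J))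
  refine subsingleton_extM_succ P _ 0 fun f hf => ?_
  obtain ⟨g, hg⟩ := exists_comp_eq_of_ker_le (P.complex.d 1 0).hom
    ((gvClosure K).subtype ∘ₗ f) (by
      rw [ker_d_eq, LinearMap.range_le_ker_iff, LinearMap.comp_assoc, hf, LinearMap.comp_zero])
  have hmem (x : P.complex.X 0) : g x ∈ gvClosure K := by
    obtain ⟨I, hI, hx⟩ := isGVTorsion_quotient hJ (augmentation P x)
    refine mem_gvClosure_of_smul_mem hI fun i hi => ?_
    have : i • x ∈ LinearMap.ker (augmentation P) := by
      rw [LinearMap.mem_ker, map_smul, hx i hi]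
    rw [ker_augmentation] at this
    obtain ⟨y, hy⟩ := this
    rw [← map_smul, ← hy, ← LinearMap.comp_apply, hg]
    exact (f y).2
  exact ⟨g.codRestrict _ hmem, LinearMap.ext fun x => Subtype.ext (LinearMap.congr_fun hg x)⟩

lemma exists_isWEnvelope (hX : IsGVTorsionFree R X) :
    ∃ (L : Type) (_ : AddCommGroup L) (_ : Module R L) (i : X →ₗ[R] L), IsWEnvelope R X L i := by
  obtain ⟨E, _, _, _, hE, i, hi⟩ := exists_injective_isGVTorsionFree_embedding hX
  refine ⟨gvClosure (LinearMap.range i), inferInstance, inferInstance,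
    i.codRestrict _ fun x => le_gvClosure _ ⟨x, rfl⟩, isWModule_gvClosure hE _,
    fun x y hxy => hi (congrArg Subtype.val hxy), fun z => ?_⟩
  obtain ⟨⟨z, J, hJ, hz⟩, rfl⟩ := Submodule.Quotient.mk_surjective _ z
  refine ⟨J, hJ, fun j hj => ?_⟩
  rw [← Submodule.Quotient.mk_smul, Submodule.Quotient.mk_eq_zero]
  obtain ⟨x, hx⟩ := hz j hj
  exact ⟨x, Subtype.ext hx⟩

lemma isWModule_torsionBy (hE : IsGVTorsionFree R E) {r : R} (hr : ∀ a : R, r * a = 0 → a = 0) :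
    IsWModule R (Submodule.torsionBy R E r) :=
  ⟨hE.submodule _, fun _ hJ => subsingleton_extM_torsionBy hr
    (fun h w _ => (isGVTorsion_quotient hJ).map_eq_zero hE h w) 0⟩

/-- Maps from a `w`-projective module to a `GV`-torsion-free injective module kill the torsion. -/
lemma IsWProjective.map_eq_zero {W : Type} [AddCommGroup W] [Module R W] (hW : IsWProjective R W)
    (hE : IsGVTorsionFree R E) {r : R} (hr : ∀ a : R, r * a = 0 → a = 0) (h : W →ₗ[R] E) (w : W)
    (hw : r • w = 0) : h w = 0 := by
  obtain ⟨L, _, _, i, hi⟩ := exists_isWEnvelope (isGVTorsionFree_quotient_torGV (R := R) (M := W))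
  have hker : LinearMap.ker (i ∘ₗ (torGV R W).mkQ) ≤ LinearMap.ker h := by
    rw [LinearMap.ker_comp_of_ker_eq_bot _ (LinearMap.ker_eq_bot.2 hi.2.1), Submodule.ker_mkQ,
      torGV, Submodule.span_le]
    rintro x ⟨J, hJ, hx⟩
    exact hE _ ⟨J, hJ, fun j hj => by rw [← map_smul, hx j hj, map_zero]⟩
  obtain ⟨g, rfl⟩ := exists_comp_eq_of_ker_le _ h hker
  refine map_eq_zero_of_isGVTorsion_extM hr hE
    (hW _ (hE.submodule _) (isWModule_torsionBy hE hr) L i hi) g _ ?_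
  rw [← map_smul, hw, map_zero]

lemma memPwDaggerInfty_torsionBy (hE : IsGVTorsionFree R E) {r : R}
    (hr : ∀ a : R, r * a = 0 → a = 0) : MemPwDaggerInfty R (Submodule.torsionBy R E r) := by
  refine ⟨hE.submodule _, fun W _ _ hW k hk => ?_⟩
  obtain ⟨n, rfl⟩ := Nat.exists_eq_add_of_le' hk
  exact subsingleton_extM_torsionBy hr (fun h w hw => hW.map_eq_zero hE hr h w hw) n

end WEnvelope

/-- every GV-torsion-free weak `w`-projective module is torsion-free. -/
theorem torsionFree_of_gvTorsionFree_weakWProjective (R : Type) [CommRing R]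
    (M : Type) [AddCommGroup M] [Module R M]
    (h1 : IsGVTorsionFree R M) (h2 : IsWeakWProjective R M)
    (r : R) (hr : ∀ a : R, r * a = 0 → a = 0) (x : M) (hx : r • x = 0) :
    x = 0 := by
  obtain ⟨E, _, _, _, hE, i, hi⟩ := exists_injective_isGVTorsionFree_embedding h1
  have := h2 _ (memPwDaggerInfty_torsionBy hE hr)
  exact (injective_iff_map_eq_zero i).1 hi x
    (map_eq_zero_of_isGVTorsion_extM hr hE isGVTorsion_of_subsingleton i x hx)
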